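/- For every union of conjunctive queries q(x⃗,s⃗) there exists a union of conjunctive queries q′(x⃗,s⃗) such that, for any ABox A containing all temporal constants occurring in q and any a⃗ ⊆ ind(A), n⃗ ⊆ tem(A): A^ℤ ⊨ q(a⃗,n⃗) if and only if [A] ⊨ q′(a⃗,n⃗). -/

import Mathlib

namespace TQL

/-! ## Syntax of TQL -/

/-- Basic roles: ⊥, a role name `P`, or an inverse role `P⁻`. -/
inductive BRole
  | bot
  | name (p : ℕ)
  | inv (p : ℕ)
deriving DecidableEq

/-- The inverse `R⁻` of a basic role. -/
def BRole.minus : BRole → BRole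
  | .bot => .bot
  | .name p => .inv p
  | .inv p => .name p

/-- Basic concepts: ⊥, a concept name `A`, or `∃R`. -/
inductive BConcept
  | bot
  | name (a : ℕ)
  | ex (r : BRole)
deriving DecidableEq

/-- TQL concepts. -/
inductive Concept
  | basic (b : BConcept)
  | inter (c₁ c₂ : Concept)
  | diaP (c : Concept)
  | diaF (c : Concept)
deriving DecidableEq

/-- TQL roles. -/
inductive Role
  | basic (r : BRole)
  | inter (s₁ s₂ : Role)
  | diaP (s : Role)
  | diaF (s : Role)
deriving DecidableEq

/-- TBox inclusions: `C ⊑ B` (B basic concept) and `S ⊑ R` (R basic role). -/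
inductive Inclusion
  | ci (c : Concept) (b : BConcept)
  | ri (s : Role) (r : BRole)
deriving DecidableEq

/-- A TQL TBox: a finite set of inclusions. -/
abbrev TBox := Finset Inclusion

/-- ABox atoms `A(a,n)` and `P(a,b,n)`. -/
inductive ABoxAtom
  | conc (a : ℕ) (x : ℕ) (n : ℤ)
  | role (p : ℕ) (x y : ℕ) (n : ℤ)
deriving DecidableEq

/-- A TQL ABox: a finite set of atoms. -/
abbrev ABox := Finset ABoxAtom

def ABoxAtom.inds : ABoxAtom → Finset ℕ
  | .conc _ x _ => {x}
  | .role _ x y _ => {x, y}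

def ABoxAtom.tems : ABoxAtom → Finset ℤ
  | .conc _ _ n => {n}
  | .role _ _ _ n => {n}

/-- `ind(A)`: the individual constants occurring in the ABox. -/
def aboxInds (A : ABox) : Finset ℕ := A.biUnion ABoxAtom.inds

/-- `tem(A)`: the temporal constants occurring in the ABox. -/
def aboxTems (A : ABox) : Finset ℤ := A.biUnion ABoxAtom.tems

/-! ### Names occurring in concepts, roles, TBoxes -/

def BRole.rnames : BRole → Finset ℕ
  | .bot => ∅
  | .name p => {p}
  | .inv p => {p}

def BConcept.cnames : BConcept → Finset ℕ
  | .bot => ∅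
  | .name a => {a}
  | .ex _ => ∅

def BConcept.rnames : BConcept → Finset ℕ
  | .bot => ∅
  | .name _ => ∅
  | .ex r => r.rnames

def Concept.cnames : Concept → Finset ℕ
  | .basic b => b.cnames
  | .inter c₁ c₂ => c₁.cnames ∪ c₂.cnames
  | .diaP c => c.cnames
  | .diaF c => c.cnames

def Concept.rnames : Concept → Finset ℕ
  | .basic b => b.rnames
  | .inter c₁ c₂ => c₁.rnames ∪ c₂.rnames
  | .diaP c => c.rnames
  | .diaF c => c.rnames

def Role.rnames : Role → Finset ℕ
  | .basic r => r.rnames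
  | .inter s₁ s₂ => s₁.rnames ∪ s₂.rnames
  | .diaP s => s.rnames
  | .diaF s => s.rnames

def Inclusion.cnames : Inclusion → Finset ℕ
  | .ci c b => c.cnames ∪ b.cnames
  | .ri _ _ => ∅

def Inclusion.rnames : Inclusion → Finset ℕ
  | .ci c b => c.rnames ∪ b.rnames
  | .ri s r => s.rnames ∪ r.rnames

/-- Concept names occurring in a TBox. -/
def cnamesT (T : TBox) : Finset ℕ := T.biUnion Inclusion.cnames

/-- Role names occurring in a TBox. -/
def rnamesT (T : TBox) : Finset ℕ := T.biUnion Inclusion.rnames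

/-- `|T|`: the number of concept and role names in `T`. -/
def sizeT (T : TBox) : ℕ := (cnamesT T).card + (rnamesT T).card

/-- `role(T)`: the role names of `T` together with their inverses. -/
def roleT (T : TBox) : Finset BRole :=
  (rnamesT T).image BRole.name ∪ (rnamesT T).image BRole.inv

/-- `|role(T)|`. -/
def roleTCard (T : TBox) : ℕ := (roleT T).card

/-! ### Normal forms -/

/-- An inclusion is in normal form if it has one of the shapes
`B₁ ⊓ B₂ ⊑ B`, `◇_F B₁ ⊑ B₂`, `◇_P B₁ ⊑ B₂` (for concepts), and analogously for roles. -/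
def Inclusion.InNF : Inclusion → Prop
  | .ci c _ =>
      (∃ B₁ B₂, c = .inter (.basic B₁) (.basic B₂)) ∨
      (∃ B, c = .diaF (.basic B)) ∨ (∃ B, c = .diaP (.basic B))
  | .ri s _ =>
      (∃ R₁ R₂, s = .inter (.basic R₁) (.basic R₂)) ∨
      (∃ R, s = .diaF (.basic R)) ∨ (∃ R, s = .diaP (.basic R))

/-- A TBox is in normal form. -/
def InNF (T : TBox) : Prop := ∀ incl ∈ T, incl.InNF

/-- A TBox in normal form is flat if no inclusion has a concept `∃R` on its right-hand side. -/
def IsFlat (T : TBox) : Prop :=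
  InNF T ∧ ∀ (c : Concept) (R : BRole), Inclusion.ci c (.ex R) ∉ T

/-! ## Semantics -/

/-- A temporal interpretation over a domain `D`: for each `n : ℤ` a structure, with rigid
injective interpretation of individual constants. -/
structure Interp (D : Type) where
  constI : ℕ → D
  constInj : Function.Injective constI
  concI : ℕ → ℤ → Set D
  roleI : ℕ → ℤ → Set (D × D)

variable {D : Type}

def BRole.interp (I : Interp D) : BRole → ℤ → Set (D × D)
  | .bot, _ => ∅
  | .name p, n => I.roleI p n
  | .inv p, n => {xy | (xy.2, xy.1) ∈ I.roleI p n}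

def BConcept.interp (I : Interp D) : BConcept → ℤ → Set D
  | .bot, _ => ∅
  | .name a, n => I.concI a n
  | .ex r, n => {x | ∃ y, (x, y) ∈ BRole.interp I r n}

def Concept.interp (I : Interp D) : Concept → ℤ → Set D
  | .basic b, n => BConcept.interp I b n
  | .inter c₁ c₂, n => Concept.interp I c₁ n ∩ Concept.interp I c₂ n
  | .diaP c, n => {x | ∃ m, m < n ∧ x ∈ Concept.interp I c m}
  | .diaF c, n => {x | ∃ m, n < m ∧ x ∈ Concept.interp I c m}

def Role.interp (I : Interp D) : Role → ℤ → Set (D × D)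
  | .basic r, n => BRole.interp I r n
  | .inter s₁ s₂, n => Role.interp I s₁ n ∩ Role.interp I s₂ n
  | .diaP s, n => {xy | ∃ m, m < n ∧ xy ∈ Role.interp I s m}
  | .diaF s, n => {xy | ∃ m, n < m ∧ xy ∈ Role.interp I s m}

/-- Satisfaction of an inclusion (globally, at all time points). -/
def Inclusion.holds (I : Interp D) : Inclusion → Prop
  | .ci c b => ∀ n, Concept.interp I c n ⊆ BConcept.interp I b n
  | .ri s r => ∀ n, Role.interp I s n ⊆ BRole.interp I r n

def ABoxAtom.holds (I : Interp D) : ABoxAtom → Prop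
  | .conc a x n => I.constI x ∈ I.concI a n
  | .role p x y n => (I.constI x, I.constI y) ∈ I.roleI p n

/-- `I` satisfies all inclusions of `T`. -/
def SatisfiesTBox (I : Interp D) (T : TBox) : Prop := ∀ incl ∈ T, incl.holds I

/-- `I` is a model of the KB `(T, A)`. -/
def IsModel (I : Interp D) (T : TBox) (A : ABox) : Prop :=
  SatisfiesTBox I T ∧ ∀ α ∈ A, α.holds I

/-- The KB `(T, A)` is consistent: it has a model (over a nonempty domain). -/
def Consistent (T : TBox) (A : ABox) : Prop :=
  ∃ (D : Type) (_ : Nonempty D) (I : Interp D), IsModel I T A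

/-! ## Conjunctive queries -/

/-- Atoms of conjunctive queries; `Sum.inl` is a constant, `Sum.inr` a variable. -/
inductive QAtom (νI νT : Type)
  | conc (a : ℕ) (ξ : ℕ ⊕ νI) (τ : ℤ ⊕ νT)
  | role (p : ℕ) (ξ ζ : ℕ ⊕ νI) (τ : ℤ ⊕ νT)
  | eq (τ σ : ℤ ⊕ νT)
  | lt (τ σ : ℤ ⊕ νT)

/-- A conjunctive query `q(x⃗, s⃗)` with `nx` free individual variables, `ns` free
temporal variables, `ny` bound individual variables and `nt` bound temporal variables. -/
structure CQ (nx ns : ℕ) where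
  ny : ℕ
  nt : ℕ
  atoms : List (QAtom (Fin nx ⊕ Fin ny) (Fin ns ⊕ Fin nt))

/-- A union of conjunctive queries. -/
abbrev UCQ (nx ns : ℕ) := List (CQ nx ns)

def evalIT {ι νI : Type} (cI : ℕ → ι) (g : νI → ι) : ℕ ⊕ νI → ι
  | .inl c => cI c
  | .inr v => g v

def evalTT {νT : Type} (g : νT → ℤ) : ℤ ⊕ νT → ℤ
  | .inl n => n
  | .inr v => g v

/-- Satisfaction of a query atom in a temporal interpretation. -/
def QAtom.holdsI {νI νT} (I : Interp D) (gI : νI → D) (gT : νT → ℤ) : QAtom νI νT → Prop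
  | .conc a ξ τ => evalIT I.constI gI ξ ∈ I.concI a (evalTT gT τ)
  | .role p ξ ζ τ => (evalIT I.constI gI ξ, evalIT I.constI gI ζ) ∈ I.roleI p (evalTT gT τ)
  | .eq τ σ => evalTT gT τ = evalTT gT σ
  | .lt τ σ => evalTT gT τ < evalTT gT σ

/-- `I ⊨ q(a⃗, n⃗)`: bound individual variables range over the domain, bound temporal
variables over ℤ. -/
def CQ.holdsInterp {nx ns} (q : CQ nx ns) (I : Interp D)
    (av : Fin nx → ℕ) (nv : Fin ns → ℤ) : Prop :=
  ∃ (bv : Fin q.ny → D) (bt : Fin q.nt → ℤ),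
    ∀ α ∈ q.atoms, QAtom.holdsI I (Sum.elim (fun i => I.constI (av i)) bv) (Sum.elim nv bt) α

/-- `(T, A) ⊨ q(a⃗, n⃗)`: certain answers. -/
def CertainAnswer (T : TBox) (A : ABox) {nx ns} (q : CQ nx ns)
    (av : Fin nx → ℕ) (nv : Fin ns → ℤ) : Prop :=
  ∀ (D : Type), Nonempty D → ∀ I : Interp D, IsModel I T A → q.holdsInterp I av nv

/-! ### Evaluation over data instances -/

/-- A two-sorted data instance: individual and temporal domains and the relations given
by its atoms (including the explicit precedence relation `<`). -/
structure DataInst where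
  indDom : Set ℕ
  temDom : Set ℤ
  concAt : ℕ → ℕ → ℤ → Prop
  roleAt : ℕ → ℕ → ℕ → ℤ → Prop
  ltAt : ℤ → ℤ → Prop

def QAtom.holdsData {νI νT} (Dt : DataInst) (gI : νI → ℕ) (gT : νT → ℤ) :
    QAtom νI νT → Prop
  | .conc a ξ τ => Dt.concAt a (evalIT id gI ξ) (evalTT gT τ)
  | .role p ξ ζ τ => Dt.roleAt p (evalIT id gI ξ) (evalIT id gI ζ) (evalTT gT τ)
  | .eq τ σ => evalTT gT τ = evalTT gT σ
  | .lt τ σ => Dt.ltAt (evalTT gT τ) (evalTT gT σ)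

/-- Evaluation of a CQ over a data instance: quantified variables range over the
individual/temporal domains of the instance. -/
def CQ.holdsOn {nx ns} (q : CQ nx ns) (Dt : DataInst)
    (av : Fin nx → ℕ) (nv : Fin ns → ℤ) : Prop :=
  ∃ (bv : Fin q.ny → ℕ), (∀ i, bv i ∈ Dt.indDom) ∧
    ∃ (bt : Fin q.nt → ℤ), (∀ j, bt j ∈ Dt.temDom) ∧
      ∀ α ∈ q.atoms, QAtom.holdsData Dt (Sum.elim av bv) (Sum.elim nv bt) α

/-- Evaluation of a UCQ over a data instance. -/
def UCQ.holdsOn {nx ns} (Q : UCQ nx ns) (Dt : DataInst)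
    (av : Fin nx → ℕ) (nv : Fin ns → ℤ) : Prop :=
  ∃ q ∈ Q, CQ.holdsOn q Dt av nv

/-- The convex closure of `tem(A)` in ℤ. -/
def temHull (A : ABox) : Set ℤ :=
  {n | ∃ n₁ ∈ aboxTems A, ∃ n₂ ∈ aboxTems A, n₁ ≤ n ∧ n ≤ n₂}

/-- The data instance `[A]`: `A` together with the precedence relation on the convex
closure of its temporal constants. -/
def bracketData (A : ABox) : DataInst where
  indDom := ↑(aboxInds A)
  temDom := temHull A
  concAt := fun a x n => ABoxAtom.conc a x n ∈ A
  roleAt := fun p x y n => ABoxAtom.role p x y n ∈ A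
  ltAt := fun n₁ n₂ => n₁ < n₂ ∧ n₁ ∈ temHull A ∧ n₂ ∈ temHull A

/-- The data instance `A^ℤ`: `A` together with the full precedence relation on ℤ. -/
def intData (A : ABox) : DataInst where
  indDom := ↑(aboxInds A)
  temDom := Set.univ
  concAt := fun a x n => ABoxAtom.conc a x n ∈ A
  roleAt := fun p x y n => ABoxAtom.role p x y n ∈ A
  ltAt := fun n₁ n₂ => n₁ < n₂

/-! ### Temporal constants of queries -/

def tcOf {νT : Type} : ℤ ⊕ νT → Finset ℤ
  | .inl n => {n}
  | .inr _ => ∅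

def QAtom.temConsts {νI νT} : QAtom νI νT → Finset ℤ
  | .conc _ _ τ => tcOf τ
  | .role _ _ _ τ => tcOf τ
  | .eq τ σ => tcOf τ ∪ tcOf σ
  | .lt τ σ => tcOf τ ∪ tcOf σ

def CQ.temConsts {nx ns} (q : CQ nx ns) : Finset ℤ :=
  (q.atoms.map QAtom.temConsts).foldr (· ∪ ·) ∅

def UCQ.temConsts {nx ns} (Q : UCQ nx ns) : Finset ℤ :=
  (Q.map CQ.temConsts).foldr (· ∪ ·) ∅

/-! ## The closure operators and canonical models -/

/-- Atoms used in the closure construction: `B(u,n)` for a basic concept `B`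
(covering `A(u,n)`, `∃R(u,n)` and `⊥(u,n)`), `R(u,v,n)` for a basic role and `(n < m)`. -/
inductive CAtom (ι : Type)
  | conc (B : BConcept) (u : ι) (n : ℤ)
  | rl (R : BRole) (u v : ι) (n : ℤ)
  | lt (n m : ℤ)

def CAtom.mentionsTime {ι} : CAtom ι → ℤ → Prop
  | .conc _ _ n, k => n = k
  | .rl _ _ _ n, k => n = k
  | .lt n m, k => n = k ∨ m = k

/-- A time point occurs in a set of atoms. -/
def timeOccurs {ι} (S : Set (CAtom ι)) (n : ℤ) : Prop := ∃ α ∈ S, CAtom.mentionsTime α n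

def CAtom.indsOf {ι} : CAtom ι → Set ι
  | .conc _ u _ => {u}
  | .rl _ u v _ => {u, v}
  | .lt _ _ => ∅

/-- The individual names occurring in a set of atoms. -/
def domOf {ι} (S : Set (CAtom ι)) : Set ι := {u | ∃ α ∈ S, u ∈ CAtom.indsOf α}

/-- `⊥` occurs in the set of atoms. -/
def hasBot {ι} (S : Set (CAtom ι)) : Prop :=
  (∃ u n, CAtom.conc .bot u n ∈ S) ∨ (∃ u v n, CAtom.rl .bot u v n ∈ S)

/-- One-step derivability by the rules (ex), (c1)–(c3), (r1)–(r3). -/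
inductive Deriv {ι} (T : TBox) (S : Set (CAtom ι)) : CAtom ι → Prop
  | ex₁ {R u v n} : CAtom.rl R u v n ∈ S → Deriv T S (.conc (.ex R) u n)
  | ex₂ {R u v n} : CAtom.rl R u v n ∈ S → Deriv T S (.conc (.ex R.minus) v n)
  | c1 {B₁ B₂ B u n} :
      Inclusion.ci (.inter (.basic B₁) (.basic B₂)) B ∈ T →
      CAtom.conc B₁ u n ∈ S → CAtom.conc B₂ u n ∈ S → Deriv T S (.conc B u n)
  | c2 {B B' u m n} :
      Inclusion.ci (.diaP (.basic B)) B' ∈ T →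
      CAtom.conc B u m ∈ S → m < n → timeOccurs S n → Deriv T S (.conc B' u n)
  | c3 {B B' u m n} :
      Inclusion.ci (.diaF (.basic B)) B' ∈ T →
      CAtom.conc B u m ∈ S → n < m → timeOccurs S n → Deriv T S (.conc B' u n)
  | r1 {R₁ R₂ R u v n} :
      Inclusion.ri (.inter (.basic R₁) (.basic R₂)) R ∈ T →
      CAtom.rl R₁ u v n ∈ S → CAtom.rl R₂ u v n ∈ S → Deriv T S (.rl R u v n)
  | r2 {R R' u v m n} :
      Inclusion.ri (.diaP (.basic R)) R' ∈ T →
      CAtom.rl R u v m ∈ S → m < n → timeOccurs S n → Deriv T S (.rl R' u v n)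
  | r3 {R R' u v m n} :
      Inclusion.ri (.diaF (.basic R)) R' ∈ T →
      CAtom.rl R u v m ∈ S → n < m → timeOccurs S n → Deriv T S (.rl R' u v n)

/-- The operator `cl`: one simultaneous (non-recursive) application of the rules. -/
def cl {ι} (T : TBox) (S : Set (CAtom ι)) : Set (CAtom ι) := S ∪ {α | Deriv T S α}

/-- `cl^∞`. -/
def clInf {ι} (T : TBox) (S : Set (CAtom ι)) : Set (CAtom ι) := ⋃ i, (cl T)^[i] S

/-! ### Tree individuals and the rule (⇝) -/

/-- Individuals of canonical models: an ABox individual constant together with a path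
of (time-offset, role) pairs recording applications of the rule (⇝);
`(a, [])` is the ABox individual `a` itself. -/
abbrev TreeInd := ℕ × List (ℤ × BRole)

/-- The absolute time at which the individual was created (sum of offsets). -/
def absOf (u : TreeInd) : ℤ := (u.2.map Prod.fst).sum

/-- The depth of a tree individual. -/
def depthOf (u : TreeInd) : ℕ := u.2.length

/-- The canonical fresh individual created by applying (⇝) to `u` at time `n` for `R`. -/
def succInd (u : TreeInd) (n : ℤ) (R : BRole) : TreeInd := (u.1, u.2 ++ [(n - absOf u, R)])

/-- The operator `cl₁`: `cl` together with the rule (⇝). -/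
def cl1 (T : TBox) (S : Set (CAtom TreeInd)) : Set (CAtom TreeInd) :=
  cl T S ∪ {α | ∃ R u n, α = CAtom.rl R u (succInd u n R) n ∧
      CAtom.conc (.ex R) u n ∈ S ∧ ∀ v, CAtom.rl R u v n ∉ S}

/-- `cl₁^∞`. -/
def cl1Inf (T : TBox) (S : Set (CAtom TreeInd)) : Set (CAtom TreeInd) := ⋃ i, (cl1 T)^[i] S

/-- `u ⇝ⁿ_R v` in the construction starting from `S`. -/
def LeadsTo (T : TBox) (S : Set (CAtom TreeInd)) (u : TreeInd) (n : ℤ) (R : BRole)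
    (v : TreeInd) : Prop :=
  v = succInd u n R ∧
    ∃ i, CAtom.conc (.ex R) u n ∈ (cl1 T)^[i] S ∧ ∀ w, CAtom.rl R u w n ∉ (cl1 T)^[i] S

/-- All atoms `(n < m)` with `n < m` in ℤ. -/
def ltAtoms {ι : Type} : Set (CAtom ι) := {α | ∃ n m : ℤ, n < m ∧ α = CAtom.lt n m}

def ABoxAtom.toC : ABoxAtom → CAtom ℕ
  | .conc a x n => .conc (.name a) x n
  | .role p x y n => .rl (.name p) x y n

def ABoxAtom.toCT : ABoxAtom → CAtom TreeInd
  | .conc a x n => .conc (.name a) (x, []) n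
  | .role p x y n => .rl (.name p) (x, []) (y, []) n

/-- The atoms of `A^ℤ` (over ABox individuals). -/
def initAtoms (A : ABox) : Set (CAtom ℕ) := (ABoxAtom.toC '' ↑A) ∪ ltAtoms

/-- The atoms of `A^ℤ` (over tree individuals). -/
def initAtomsT (A : ABox) : Set (CAtom TreeInd) := (ABoxAtom.toCT '' ↑A) ∪ ltAtoms

/-- The canonical model of a KB with a flat TBox, as a set of atoms over `ind(A)`. -/
def CKflat (T : TBox) (A : ABox) : Set (CAtom ℕ) := clInf T (initAtoms A)

/-- The canonical model `C_K` of a KB, identified with the set of atoms `cl₁^∞(A^ℤ)`. -/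
def CK (T : TBox) (A : ABox) : Set (CAtom TreeInd) := cl1Inf T (initAtomsT A)

/-! ### Evaluating CQs in canonical models (as sets of atoms) -/

def QAtom.holdsC {ι νI νT} (S : Set (CAtom ι)) (cI : ℕ → ι) (gI : νI → ι) (gT : νT → ℤ) :
    QAtom νI νT → Prop
  | .conc a ξ τ => CAtom.conc (.name a) (evalIT cI gI ξ) (evalTT gT τ) ∈ S
  | .role p ξ ζ τ =>
      CAtom.rl (.name p) (evalIT cI gI ξ) (evalIT cI gI ζ) (evalTT gT τ) ∈ S
  | .eq τ σ => evalTT gT τ = evalTT gT σ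
  | .lt τ σ => evalTT gT τ < evalTT gT σ

/-- Satisfaction of a CQ in a canonical model given as a set of atoms, with quantified
individual variables ranging over `dom` and temporal variables over ℤ. -/
def CQ.holdsC {nx ns ι} (q : CQ nx ns) (S : Set (CAtom ι)) (dom : Set ι) (cI : ℕ → ι)
    (av : Fin nx → ℕ) (nv : Fin ns → ℤ) : Prop :=
  ∃ (bv : Fin q.ny → ι), (∀ i, bv i ∈ dom) ∧ ∃ (bt : Fin q.nt → ℤ),
    ∀ α ∈ q.atoms, QAtom.holdsC S cI (Sum.elim (fun i => cI (av i)) bv) (Sum.elim nv bt) α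

/-! ### `K_{T,R}` and concept normal form -/

/-- The TBox of `K_{T,R}`: `T ∪ {A_g ⊑ ∃R}` where `g` is (the index of) a fresh
concept name. -/
def KTRT (T : TBox) (g : ℕ) (R : BRole) : TBox :=
  insert (.ci (.basic (.name g)) (.ex R)) T

/-- The ABox of `K_{T,R}`: `{A_g(a, 0)}`. -/
def KTRA (g a : ℕ) : ABox := {ABoxAtom.conc g a 0}

/-- The canonical model of `K_{T,R}` (as a set of atoms). -/
def CKTR (T : TBox) (g a : ℕ) (R : BRole) : Set (CAtom TreeInd) :=
  CK (KTRT T g R) (KTRA g a)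

/-- `T` is in concept normal form (CoNF). -/
def IsCoNF (T : TBox) : Prop :=
  InNF T ∧ ∀ R ∈ roleT T, ∃ Af : ℤ → ℕ,
    Inclusion.ci (.basic (.ex R)) (.name (Af 0)) ∈ T ∧
    Inclusion.ci (.diaF (.basic (.ex R))) (.name (Af (-1))) ∈ T ∧
    (∀ m : ℕ, m ≤ roleTCard T →
      Inclusion.ci (.diaF (.basic (.name (Af (-(m : ℤ)))))) (.name (Af (-(m : ℤ) - 1))) ∈ T) ∧
    Inclusion.ci (.diaP (.basic (.ex R))) (.name (Af 1)) ∈ T ∧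
    (∀ m : ℕ, m ≤ roleTCard T →
      Inclusion.ci (.diaP (.basic (.name (Af (m : ℤ))))) (.name (Af ((m : ℤ) + 1))) ∈ T) ∧
    (∀ m : ℤ, |m| ≤ (roleTCard T : ℤ) → ∀ R' : BRole, ∀ g a : ℕ, g ∉ cnamesT T →
      CAtom.rl R' (a, ([] : List (ℤ × BRole))) (succInd (a, []) 0 R) m ∈ CKTR T g a R →
      Inclusion.ci (.basic (.name (Af m))) (.ex R') ∈ T)

/-! ### Restrictions of canonical models -/

/-- `C_K^d`: restriction to individuals of depth at most `d`. -/
def CKd (T : TBox) (A : ABox) (d : ℕ) : Set (CAtom TreeInd) :=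
  {α | α ∈ CK T A ∧ ∀ u ∈ CAtom.indsOf α, depthOf u ≤ d}

/-- `n` lies in `[min tem(A) − ℓ, max tem(A) + ℓ]`. -/
def inWindow (A : ABox) (ℓ : ℕ) (n : ℤ) : Prop :=
  ∃ n₁ ∈ aboxTems A, ∃ n₂ ∈ aboxTems A, n₁ - ℓ ≤ n ∧ n ≤ n₂ + ℓ

/-- `C_K^{d,ℓ}`: further restriction to time points in the window. -/
def CKdl (T : TBox) (A : ABox) (d ℓ : ℕ) : Set (CAtom TreeInd) :=
  {α | α ∈ CKd T A d ∧ ∀ n, CAtom.mentionsTime α n → inWindow A ℓ n}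


/-! ### Ranking time points relative to the convex closure of `tem(A)` -/

lemma mem_temHull {A : ABox} {n : ℤ} (h : n ∈ aboxTems A) : n ∈ temHull A :=
  ⟨n, h, n, h, le_rfl, le_rfl⟩

lemma mem_temHull_of_conc_mem {A : ABox} {a x : ℕ} {n : ℤ} (h : ABoxAtom.conc a x n ∈ A) :
    n ∈ temHull A :=
  mem_temHull (Finset.mem_biUnion.2 ⟨_, h, by simp [ABoxAtom.tems]⟩)

lemma mem_temHull_of_role_mem {A : ABox} {p x y : ℕ} {n : ℤ} (h : ABoxAtom.role p x y n ∈ A) :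
    n ∈ temHull A :=
  mem_temHull (Finset.mem_biUnion.2 ⟨_, h, by simp [ABoxAtom.tems]⟩)

lemma exists_bound_temHull (A : ABox) : ∃ B : ℤ, 0 ≤ B ∧ ∀ n ∈ temHull A, -B ≤ n ∧ n ≤ B := by
  refine ⟨∑ n ∈ aboxTems A, |n|, Finset.sum_nonneg fun n _ => abs_nonneg n, ?_⟩
  rintro n ⟨a, ha, b, hb, han, hnb⟩
  have h := fun c (hc : c ∈ aboxTems A) =>
    abs_le.1 (Finset.single_le_sum (f := fun n : ℤ => |n|) (fun n _ => abs_nonneg n) hc)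
  exact ⟨(h a ha).1.trans han, hnb.trans (h b hb).2⟩

/-- Finitely many time points can be ranked by bounded integers so that rank `0` is the convex
closure of `tem(A)` and the order outside of it is preserved. -/
lemma exists_rank (A : ABox) {N : ℕ} (t : Fin N → ℤ) :
    ∃ ρ : ℤ → ℤ, (∀ n, -(N : ℤ) ≤ ρ n ∧ ρ n ≤ N) ∧ (∀ n ∈ temHull A, ρ n = 0) ∧
      (∀ j, t j ∉ temHull A → ρ (t j) ≠ 0) ∧
      ∀ n m, n ∈ temHull A ∪ Set.range t → m ∈ temHull A ∪ Set.range t → n < m →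
        ρ n < ρ m ∨ n ∈ temHull A ∧ m ∈ temHull A := by
  classical
  let above (n : ℤ) : Prop := ∀ h ∈ aboxTems A, h < n
  let below (n : ℤ) : Prop := (aboxTems A).Nonempty ∧ ∀ h ∈ aboxTems A, n < h
  have trich : ∀ n, n ∈ temHull A ∨ above n ∨ below n := by
    intro n
    by_contra! hn
    obtain ⟨h1, h2, h3⟩ := hn
    simp only [above, not_forall, not_lt] at h2
    obtain ⟨b, hb, hnb⟩ := h2
    simp only [below, not_and, not_forall, not_lt] at h3
    obtain ⟨a, ha, han⟩ := h3 ⟨b, hb⟩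
    exact h1 ⟨a, ha, b, hb, han, hnb⟩
  have above_mono : ∀ {n m}, above n → n ≤ m → above m :=
    fun h hnm x hx => (h x hx).trans_le hnm
  have below_anti : ∀ {n m}, below m → n ≤ m → below n :=
    fun h hnm => ⟨h.1, fun x hx => hnm.trans_lt (h.2 x hx)⟩
  have hull_not_above : ∀ {n}, n ∈ temHull A → ¬ above n := by
    rintro n ⟨_, _, b, hb, _, hnb⟩ h
    exact (h b hb).not_ge hnb
  have hull_not_below : ∀ {n}, n ∈ temHull A → ¬ below n := by
    rintro n ⟨a, ha, _, _, han, _⟩ h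
    exact (h.2 a ha).not_ge han
  have not_both : ∀ {n}, above n → ¬ below n := by
    rintro n h ⟨⟨x, hx⟩, h'⟩
    exact (h x hx).asymm (h' x hx)
  let up (n : ℤ) : Finset (Fin N) := {k | above (t k) ∧ t k ≤ n}
  let down (n : ℤ) : Finset (Fin N) := {k | below (t k) ∧ n ≤ t k}
  have up_le : ∀ n, (up n).card ≤ N := fun n => by simpa using Finset.card_le_univ (up n)
  have down_le : ∀ n, (down n).card ≤ N := fun n => by simpa using Finset.card_le_univ (down n)
  have up_zero : ∀ n, ¬ above n → (up n).card = 0 := by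
    intro n hn
    rw [Finset.card_eq_zero, Finset.filter_eq_empty_iff]
    exact fun k _ hk => hn (above_mono hk.1 hk.2)
  have down_zero : ∀ n, ¬ below n → (down n).card = 0 := by
    intro n hn
    rw [Finset.card_eq_zero, Finset.filter_eq_empty_iff]
    exact fun k _ hk => hn (below_anti hk.1 hk.2)
  have up_pos : ∀ k, above (t k) → 0 < (up (t k)).card := fun k hk =>
    Finset.card_pos.2 ⟨k, by simp [up, hk]⟩
  have down_pos : ∀ k, below (t k) → 0 < (down (t k)).card := fun k hk =>
    Finset.card_pos.2 ⟨k, by simp [down, hk]⟩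
  refine ⟨fun n => (up n).card - (down n).card, fun n => ?_, fun n hn => ?_, fun j hj => ?_,
    fun n m hn hm hnm => ?_⟩
  · have := up_le n
    have := down_le n
    dsimp only
    omega
  · simp [up_zero n (hull_not_above hn), down_zero n (hull_not_below hn)]
  · rcases (trich (t j)).resolve_left hj with h | h
    · have := up_pos j h
      have := down_zero _ (not_both h)
      dsimp only
      omega
    · have := down_pos j h
      have := up_zero _ fun h' => not_both h' h
      dsimp only
      omega
  · have hup : (up n).card ≤ (up m).card := Finset.card_le_card fun k hk => by
      simp only [up, Finset.mem_filter_univ] at hk ⊢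
      exact ⟨hk.1, hk.2.trans hnm.le⟩
    have hdown : (down m).card ≤ (down n).card := Finset.card_le_card fun k hk => by
      simp only [down, Finset.mem_filter_univ] at hk ⊢
      exact ⟨hk.1, hnm.le.trans hk.2⟩
    by_cases ham : above m
    · obtain ⟨k, rfl⟩ := hm.resolve_left fun h => hull_not_above h ham
      have : (up n).card < (up (t k)).card := by
        refine Finset.card_lt_card (Finset.ssubset_iff_of_subset (fun i hi => ?_) |>.2 ⟨k, ?_, ?_⟩)
        · simp only [up, Finset.mem_filter_univ] at hi ⊢
          exact ⟨hi.1, hi.2.trans hnm.le⟩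
        · simp [up, ham]
        · simp [up, hnm]
      left
      dsimp only
      omega
    by_cases hbn : below n
    · obtain ⟨k, rfl⟩ := hn.resolve_left fun h => hull_not_below h hbn
      have : (down m).card < (down (t k)).card := by
        refine Finset.card_lt_card (Finset.ssubset_iff_of_subset (fun i hi => ?_) |>.2 ⟨k, ?_, ?_⟩)
        · simp only [down, Finset.mem_filter_univ] at hi ⊢
          exact ⟨hi.1, hnm.le.trans hi.2⟩
        · simp [down, hbn]
        · simp [down, hnm]
      left
      dsimp only
      omega
    right
    constructor
    · rcases trich n with h | h | h
      exacts [h, (ham (above_mono h hnm.le)).elim, (hbn h).elim]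
    · rcases trich m with h | h | h
      exacts [h, (ham h).elim, (hbn (below_anti h hnm.le)).elim]

/-! ### Translating queries along a ranking -/

/-- Translation of a query atom when each temporal term is assigned a rank by `r`: the terms of
rank `0` are renamed by `tr`, and conditions on other terms are decided by their ranks. -/
def QAtom.relocate {νI νT νT' : Type} (r : ℤ ⊕ νT → ℤ) (tr : ℤ ⊕ νT → ℤ ⊕ νT') :
    QAtom νI νT → QAtom νI νT'
  | .conc a ξ τ => if r τ = 0 then .conc a ξ (tr τ) else .lt (.inl 0) (.inl 0)
  | .role p ξ ζ τ => if r τ = 0 then .role p ξ ζ (tr τ) else .lt (.inl 0) (.inl 0)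
  | .eq τ σ =>
      if r τ = 0 ∧ r σ = 0 then .eq (tr τ) (tr σ)
      else if r τ = r σ then .eq (.inl 0) (.inl 0) else .lt (.inl 0) (.inl 0)
  | .lt τ σ =>
      if r τ = 0 ∧ r σ = 0 then .lt (tr τ) (tr σ)
      else if r τ < r σ then .eq (.inl 0) (.inl 0) else .lt (.inl 0) (.inl 0)

lemma QAtom.holdsData_relocate {νI νT νT' : Type} {A : ABox} (gI : νI → ℕ) {gT : νT → ℤ}
    {gT' : νT' → ℤ} {r : ℤ ⊕ νT → ℤ} {tr : ℤ ⊕ νT → ℤ ⊕ νT'}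
    (hzero : ∀ τ, tcOf τ ⊆ aboxTems A → r τ = 0 →
      evalTT gT' (tr τ) = evalTT gT τ ∧ evalTT gT τ ∈ temHull A)
    (hne : ∀ τ, tcOf τ ⊆ aboxTems A → r τ ≠ 0 → evalTT gT τ ∉ temHull A)
    (hlt : ∀ τ σ, tcOf τ ⊆ aboxTems A → tcOf σ ⊆ aboxTems A →
      (evalTT gT τ < evalTT gT σ ↔
        r τ < r σ ∨ r τ = 0 ∧ r σ = 0 ∧ evalTT gT τ < evalTT gT σ))
    (α : QAtom νI νT) (hα : α.temConsts ⊆ aboxTems A) :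
    (α.relocate r tr).holdsData (bracketData A) gI gT' ↔ α.holdsData (intData A) gI gT := by
  cases α with
  | conc a ξ τ =>
    by_cases h : r τ = 0
    · simp [relocate, holdsData, h, hzero τ hα h, bracketData, intData]
    · have := fun h' => hne τ hα h (mem_temHull_of_conc_mem (A := A) (a := a)
        (x := evalIT id gI ξ) h')
      simpa [relocate, holdsData, h, bracketData, intData] using this
  | role p ξ ζ τ =>
    by_cases h : r τ = 0
    · simp [relocate, holdsData, h, hzero τ hα h, bracketData, intData]
    · have := fun h' => hne τ hα h (mem_temHull_of_role_mem (A := A) (p := p)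
        (x := evalIT id gI ξ) (y := evalIT id gI ζ) h')
      simpa [relocate, holdsData, h, bracketData, intData] using this
  | eq τ σ =>
    obtain ⟨hτ, hσ⟩ := Finset.union_subset_iff.1 hα
    by_cases h : r τ = 0 ∧ r σ = 0
    · simp [relocate, holdsData, h, hzero τ hτ h.1, hzero σ hσ h.2]
    · have h1 := hlt τ σ hτ hσ
      have h2 := hlt σ τ hσ hτ
      by_cases h' : r τ = r σ
      · simp only [relocate, if_neg h, if_pos h', holdsData, true_iff]
        omega
      · simp only [relocate, if_neg h, if_neg h', holdsData, bracketData, lt_irrefl, false_and,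
          false_iff]
        omega
  | lt τ σ =>
    obtain ⟨hτ, hσ⟩ := Finset.union_subset_iff.1 hα
    by_cases h : r τ = 0 ∧ r σ = 0
    · simp [relocate, holdsData, h, hzero τ hτ h.1, hzero σ hσ h.2, bracketData, intData]
    · have h1 := hlt τ σ hτ hσ
      by_cases h' : r τ < r σ
      · simp only [relocate, if_neg h, if_pos h', holdsData, intData, true_iff]
        omega
      · simp only [relocate, if_neg h, if_neg h', holdsData, bracketData, intData, lt_irrefl,
          false_and, false_iff]
        omega

/-- The rank of a temporal term when the bound variables are ranked by `f`. -/
def termRank {ns nt : ℕ} (f : Fin nt → ℤ) : ℤ ⊕ (Fin ns ⊕ Fin nt) → ℤ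
  | .inr (.inr j) => f j
  | _ => 0

/-- The renaming of temporal terms that keeps only the bound variables of rank `0`. -/
noncomputable def termRename {ns nt : ℕ} (f : Fin nt → ℤ) :
    ℤ ⊕ (Fin ns ⊕ Fin nt) → ℤ ⊕ (Fin ns ⊕ Fin (Fintype.card {j // f j = 0}))
  | .inl n => .inl n
  | .inr (.inl i) => .inr (.inl i)
  | .inr (.inr j) =>
      if h : f j = 0 then .inr (.inr (Fintype.equivFin {j // f j = 0} ⟨j, h⟩)) else .inl 0

/-- The translation of a conjunctive query when its bound temporal variables are ranked by `f`. -/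
noncomputable def CQ.relocate {nx ns : ℕ} (c : CQ nx ns) (f : Fin c.nt → ℤ) : CQ nx ns where
  ny := c.ny
  nt := Fintype.card {j // f j = 0}
  atoms := c.atoms.map (QAtom.relocate (termRank f) (termRename f))

/-- The disjunction of the translations of `c` for all rankings of bounded size. -/
noncomputable def CQ.bracketUCQ {nx ns : ℕ} (c : CQ nx ns) : UCQ nx ns :=
  (Fintype.piFinset fun _ : Fin c.nt => Finset.Icc (-(c.nt : ℤ)) c.nt).toList.map c.relocate

lemma CQ.holdsOn_bracketUCQ {nx ns : ℕ} (c : CQ nx ns) {A : ABox}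
    (hc : ∀ α ∈ c.atoms, α.temConsts ⊆ aboxTems A) (av : Fin nx → ℕ) (nv : Fin ns → ℤ)
    (hnv : ∀ j, nv j ∈ aboxTems A) :
    UCQ.holdsOn c.bracketUCQ (bracketData A) av nv ↔ c.holdsOn (intData A) av nv := by
  constructor
  · rintro ⟨_, hq, bv, hbv, bt', hbt', hα⟩
    obtain ⟨f, -, rfl⟩ := List.mem_map.1 hq
    obtain ⟨B, hB0, hB⟩ := exists_bound_temHull A
    let bt (j : Fin c.nt) : ℤ :=
      if h : f j = 0 then bt' (Fintype.equivFin {j // f j = 0} ⟨j, h⟩)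
      else if 0 < f j then B + f j else -B + f j
    have hzero : ∀ τ, tcOf τ ⊆ aboxTems A → termRank f τ = 0 →
        evalTT (Sum.elim nv bt') (termRename f τ) = evalTT (Sum.elim nv bt) τ ∧
          evalTT (Sum.elim nv bt) τ ∈ temHull A := by
      rintro (n | i | j) hτ hr
      · exact ⟨rfl, mem_temHull (Finset.singleton_subset_iff.1 hτ)⟩
      · exact ⟨rfl, mem_temHull (hnv i)⟩
      · have h : f j = 0 := hr
        simp only [termRename, evalTT, bt, h, dite_true, Sum.elim_inr]
        exact ⟨rfl, hbt' _⟩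
    have hpos : ∀ τ, 0 < termRank f τ → evalTT (Sum.elim nv bt) τ = B + termRank f τ := by
      rintro (n | i | j) hr
      · exact (lt_irrefl _ hr).elim
      · exact (lt_irrefl _ hr).elim
      · have h : 0 < f j := hr
        simp [evalTT, termRank, bt, h, h.ne']
    have hneg : ∀ τ, termRank f τ < 0 → evalTT (Sum.elim nv bt) τ = -B + termRank f τ := by
      rintro (n | i | j) hr
      · exact (lt_irrefl _ hr).elim
      · exact (lt_irrefl _ hr).elim
      · have h : f j < 0 := hr
        simp [evalTT, termRank, bt, h.not_gt, h.ne]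
    have hbd : ∀ τ, tcOf τ ⊆ aboxTems A → termRank f τ = 0 →
        -B ≤ evalTT (Sum.elim nv bt) τ ∧ evalTT (Sum.elim nv bt) τ ≤ B :=
      fun τ hτ hr => hB _ (hzero τ hτ hr).2
    refine ⟨bv, hbv, bt, fun _ => Set.mem_univ _, fun α hm => ?_⟩
    refine (QAtom.holdsData_relocate _ hzero (fun τ hτ hr hmem => ?_) (fun τ σ hτ hσ => ?_) α
      (hc α hm)).1 (hα _ (List.mem_map_of_mem hm))
    · have := hB _ hmem
      have := hpos τ
      have := hneg τ
      omega
    · have := hbd τ hτ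
      have := hpos τ
      have := hneg τ
      have := hbd σ hσ
      have := hpos σ
      have := hneg σ
      omega
  · rintro ⟨bv, hbv, bt, -, hα⟩
    obtain ⟨ρ, hρ, hρ0, hρne, hρlt⟩ := exists_rank A bt
    let f (j : Fin c.nt) : ℤ := ρ (bt j)
    have hf : ∀ j, f j = 0 → bt j ∈ temHull A := fun j h => not_imp_comm.1 (hρne j) (not_not.2 h)
    have hr : ∀ τ, tcOf τ ⊆ aboxTems A → termRank f τ = ρ (evalTT (Sum.elim nv bt) τ) ∧
        evalTT (Sum.elim nv bt) τ ∈ temHull A ∪ Set.range bt := by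
      rintro (n | i | j) hτ
      · have := mem_temHull (Finset.singleton_subset_iff.1 hτ)
        exact ⟨(hρ0 _ this).symm, .inl this⟩
      · have := mem_temHull (hnv i)
        exact ⟨(hρ0 _ this).symm, .inl this⟩
      · exact ⟨rfl, .inr ⟨j, rfl⟩⟩
    refine ⟨c.relocate f, List.mem_map_of_mem ?_, bv, hbv,
      fun k => bt ((Fintype.equivFin {j // f j = 0}).symm k),
      fun k => hf _ ((Fintype.equivFin {j // f j = 0}).symm k).2, fun β hβ => ?_⟩
    · simpa using fun j => hρ (bt j)
    · obtain ⟨α, hm, rfl⟩ := List.mem_map.1 hβ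
      refine (QAtom.holdsData_relocate _ ?_ (fun τ hτ h hmem => ?_) (fun τ σ hτ hσ => ?_) α
        (hc α hm)).2 (hα _ hm)
      · rintro (n | i | j) hτ h
        · exact ⟨rfl, mem_temHull (Finset.singleton_subset_iff.1 hτ)⟩
        · exact ⟨rfl, mem_temHull (hnv i)⟩
        · have h : f j = 0 := h
          simp only [termRename, evalTT, h, dite_true, Sum.elim_inr]
          exact ⟨congrArg (fun k : {j // f j = 0} => bt k)
            ((Fintype.equivFin {j // f j = 0}).symm_apply_apply ⟨j, h⟩), hf j h⟩
      · exact h ((hr τ hτ).1.trans (hρ0 _ hmem))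
      · obtain ⟨h1, h2⟩ := hr τ hτ
        obtain ⟨h3, h4⟩ := hr σ hσ
        rw [h1, h3]
        rcases lt_trichotomy (evalTT (Sum.elim nv bt) τ) (evalTT (Sum.elim nv bt) σ) with h | h | h
        · rcases hρlt _ _ h2 h4 h with h' | ⟨h', h''⟩
          · simp [h, h']
          · simp [h, hρ0 _ h', hρ0 _ h'']
        · simp [h]
        · rcases hρlt _ _ h4 h2 h with h' | ⟨h', h''⟩
          · simp [h.not_gt, h'.not_gt]
          · simp [h.not_gt, hρ0 _ h', hρ0 _ h'']

lemma subset_foldr_union_map {α : Type*} (g : α → Finset ℤ) {l : List α} {a : α} (ha : a ∈ l) :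
    g a ⊆ (l.map g).foldr (· ∪ ·) ∅ := by
  induction l with
  | nil => simp at ha
  | cons b l ih =>
    rcases List.mem_cons.1 ha with rfl | h
    · exact Finset.subset_union_left
    · exact (ih h).trans Finset.subset_union_right

/-- Lemma 2.
For every UCQ `q(x⃗,s⃗)` there is a UCQ `q′(x⃗,s⃗)` such that for any ABox `A` containing
all temporal constants of `q` and any `a⃗ ⊆ ind(A)`, `n⃗ ⊆ tem(A)`:
`A^ℤ ⊨ q(a⃗,n⃗)` iff `[A] ⊨ q′(a⃗,n⃗)`. -/
theorem ucq_over_intData_to_bracketData (nx ns : ℕ) (q : UCQ nx ns) :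
    ∃ q' : UCQ nx ns, ∀ A : ABox, UCQ.temConsts q ⊆ aboxTems A →
      ∀ (av : Fin nx → ℕ) (nv : Fin ns → ℤ),
        (∀ i, av i ∈ aboxInds A) → (∀ j, nv j ∈ aboxTems A) →
        (UCQ.holdsOn q (intData A) av nv ↔ UCQ.holdsOn q' (bracketData A) av nv) := by
  refine ⟨q.flatMap CQ.bracketUCQ, fun A hA av nv _ hnv => ?_⟩
  have key : ∀ c ∈ q, (UCQ.holdsOn c.bracketUCQ (bracketData A) av nv ↔
      c.holdsOn (intData A) av nv) := fun c hc =>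
    c.holdsOn_bracketUCQ (fun α hα => (subset_foldr_union_map QAtom.temConsts hα).trans
      ((subset_foldr_union_map CQ.temConsts hc).trans hA)) av nv hnv
  constructor
  · rintro ⟨c, hc, h⟩
    obtain ⟨c', hc', h'⟩ := (key c hc).2 h
    exact ⟨c', List.mem_flatMap.2 ⟨c, hc, hc'⟩, h'⟩
  · rintro ⟨c', hc', h'⟩
    obtain ⟨c, hc, hcc'⟩ := List.mem_flatMap.1 hc'
    exact ⟨c, hc, (key c hc).1 ⟨c', hcc', h'⟩⟩

end TQL
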